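/- Let R_0 be the kernel of the winding number map α : F_{s-1} → ℤ (each generator ↦ 1). The abelianization R_0/R_0' is a free module of rank s-2 over the group ring ℤ[ℤ] ≅ ℤ[t, t^{-1}], where t acts by conjugation by x_1, with free basis the classes of β_j = x_j x_1^{-1} for 2 ≤ j ≤ s-1. -/

import Mathlib

open LaurentPolynomial

namespace WindingKernel

/-- The affine permutation `m ↦ t m + b` of a module over `ℤ[t,t⁻¹]`. -/
noncomputable def affinePerm {M : Type*} [AddCommGroup M] [Module (LaurentPolynomial ℤ) M]
    (b : M) : Equiv.Perm M where
  toFun m := (T 1 : LaurentPolynomial ℤ) • m + b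
  invFun m := (T (-1) : LaurentPolynomial ℤ) • (m - b)
  left_inv m := by
    dsimp only
    rw [add_sub_cancel_right, smul_smul, ← T_add, neg_add_cancel, T_zero, one_smul]
  right_inv m := by
    dsimp only
    rw [smul_smul, ← T_add, add_neg_cancel, T_zero, one_smul, sub_add_cancel]

/-- The action of the free group by affine permutations in which the generator `i` acts as
`m ↦ t m + b i`. -/
noncomputable def affineAction {ι M : Type*} [AddCommGroup M] [Module (LaurentPolynomial ℤ) M]
    (b : ι → M) : FreeGroup ι →* Equiv.Perm M :=
  FreeGroup.lift fun i => affinePerm (b i)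

section Affine

variable {ι M : Type*} [AddCommGroup M] [Module (LaurentPolynomial ℤ) M] (b : ι → M)
  {α : FreeGroup ι →* Multiplicative ℤ}

theorem affineAction_of (i : ι) (m : M) :
    affineAction b (FreeGroup.of i) m = (T 1 : LaurentPolynomial ℤ) • m + b i := by
  simp [affineAction, affinePerm]

theorem affineAction_apply (hα : ∀ i, α (FreeGroup.of i) = Multiplicative.ofAdd 1)
    (w : FreeGroup ι) (m : M) :
    affineAction b w m =
      (T (α w).toAdd : LaurentPolynomial ℤ) • m + affineAction b w 0 := by
  induction w using FreeGroup.induction_on generalizing m with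
  | C1 => simp
  | of i => simp [affineAction_of, hα]
  | inv_of i _ =>
    simp [affineAction, affinePerm, hα, sub_eq_add_neg]
  | mul x y hx hy =>
    rw [map_mul, Equiv.Perm.mul_apply, Equiv.Perm.mul_apply, hx, hy, hx (affineAction b y 0)]
    rw [map_mul, toAdd_mul, T_add, smul_add, smul_smul, add_assoc]

theorem affineAction_mul_zero (hα : ∀ i, α (FreeGroup.of i) = Multiplicative.ofAdd 1)
    (v w : FreeGroup ι) :
    affineAction b (v * w) 0 =
      (T (α v).toAdd : LaurentPolynomial ℤ) • affineAction b w 0 + affineAction b v 0 := by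
  rw [map_mul, Equiv.Perm.mul_apply, affineAction_apply b hα]

theorem affineAction_conj_zero (hα : ∀ i, α (FreeGroup.of i) = Multiplicative.ofAdd 1)
    (w : FreeGroup ι) {a : FreeGroup ι} (ha : α a = 1) :
    affineAction b (w * a * w⁻¹) 0 =
      (T (α w).toAdd : LaurentPolynomial ℤ) • affineAction b a 0 := by
  have h := affineAction_mul_zero b hα w w⁻¹
  rw [mul_inv_cancel, map_one, Equiv.Perm.one_apply] at h
  rw [affineAction_mul_zero b hα, affineAction_mul_zero b hα, map_mul, ha, mul_one,
    add_left_comm, ← h, add_zero]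

/-- The homomorphism from the abelianized kernel of `α` given by the orbit map of `0`. -/
noncomputable def kerAbToModule (hα : ∀ i, α (FreeGroup.of i) = Multiplicative.ofAdd 1) :
    Additive (Abelianization α.ker) →+ M :=
  MonoidHom.toAdditiveLeft <| Abelianization.lift
    { toFun := fun a : α.ker => Multiplicative.ofAdd (affineAction b (a : FreeGroup ι) 0)
      map_one' := by simp
      map_mul' := fun x y => by
        rw [Subgroup.coe_mul, affineAction_mul_zero b hα, MonoidHom.mem_ker.1 x.2, ← ofAdd_add]
        simp [add_comm] }

theorem kerAbToModule_of (hα : ∀ i, α (FreeGroup.of i) = Multiplicative.ofAdd 1) (a : α.ker) :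
    kerAbToModule b hα (Additive.ofMul (Abelianization.of a)) =
      affineAction b (a : FreeGroup ι) 0 := rfl

end Affine

section Conjugation

variable {G : Type*} [Group G] (N : Subgroup G) [N.Normal]

theorem ofMul_abelianizationOf_surjective (H : Type*) [Group H] :
    Function.Surjective fun a : H => Additive.ofMul (Abelianization.of a) :=
  QuotientGroup.mk_surjective

/-- The conjugation action of a group on the abelianization of a normal subgroup. -/
noncomputable def conjEnd : G →* Module.End ℤ (Additive (Abelianization N)) where
  toFun g := (MonoidHom.toAdditive
    (Abelianization.map (MulAut.conjNormal g : MulAut N).toMonoidHom)).toIntLinearMap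
  map_one' := by
    ext x
    obtain ⟨a, rfl⟩ := ofMul_abelianizationOf_surjective N x
    simp
  map_mul' g h := by
    ext x
    obtain ⟨a, rfl⟩ := ofMul_abelianizationOf_surjective N x
    simp

theorem conjEnd_of (g : G) (a : N) :
    conjEnd N g (Additive.ofMul (Abelianization.of a)) =
      Additive.ofMul (Abelianization.of (MulAut.conjNormal g a)) := rfl

/-- The `ℤ[t,t⁻¹]`-action on the abelianization of a normal subgroup in which `t` acts as
conjugation by `g`. -/
noncomputable def laurentEnd (g : G) :
    LaurentPolynomial ℤ →ₐ[ℤ] Module.End ℤ (Additive (Abelianization N)) :=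
  AddMonoidAlgebra.lift ℤ _ ℤ ((conjEnd N).comp (zpowersHom G g))

theorem laurentEnd_T (g : G) (n : ℤ) : laurentEnd N g (T n) = conjEnd N (g ^ n) :=
  (AddMonoidAlgebra.lift_single _ _ _).trans (one_smul _ _)

end Conjugation

section Inverse

variable {ι : Type*} {α : FreeGroup ι →* Multiplicative ℤ}

theorem kerAbToModule_conjEnd {M : Type*} [AddCommGroup M] [Module (LaurentPolynomial ℤ) M]
    (b : ι → M) (hα : ∀ i, α (FreeGroup.of i) = Multiplicative.ofAdd 1) (w : FreeGroup ι)
    (x : Additive (Abelianization α.ker)) :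
    kerAbToModule b hα (conjEnd α.ker w x) =
      (T (α w).toAdd : LaurentPolynomial ℤ) • kerAbToModule b hα x := by
  obtain ⟨a, rfl⟩ := ofMul_abelianizationOf_surjective _ x
  exact affineAction_conj_zero b hα w a.2

theorem kerAbToModule_laurentEnd {M : Type*} [AddCommGroup M] [Module (LaurentPolynomial ℤ) M]
    (b : ι → M) (hα : ∀ i, α (FreeGroup.of i) = Multiplicative.ofAdd 1) (i : ι)
    (p : LaurentPolynomial ℤ) (x : Additive (Abelianization α.ker)) :
    kerAbToModule b hα (laurentEnd α.ker (FreeGroup.of i) p x) =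
      p • kerAbToModule b hα x := by
  induction p using LaurentPolynomial.induction_on' with
  | add p q hp hq => simp [add_smul, hp, hq]
  | C_mul_T n c =>
    have hc : (C c * T n : LaurentPolynomial ℤ) = c • T n := by
      rw [← LaurentPolynomial.smul_eq_C_mul]
    rw [hc, map_smul, LinearMap.smul_apply, map_zsmul, laurentEnd_T, kerAbToModule_conjEnd,
      map_zpow, hα, smul_assoc, ← ofAdd_zsmul, toAdd_ofAdd, smul_eq_mul, mul_one]

/-- An element `w` of the free group, normalized by a power of the generator `i` to lie in the
kernel of `α`. -/
def normalize (hα : ∀ i, α (FreeGroup.of i) = Multiplicative.ofAdd 1) (i : ι)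
    (w : FreeGroup ι) : α.ker :=
  ⟨w * FreeGroup.of i ^ (-(α w).toAdd), by
    rw [MonoidHom.mem_ker, map_mul, map_zpow, hα, ← ofAdd_zsmul]
    simp⟩

theorem normalize_mul (hα : ∀ i, α (FreeGroup.of i) = Multiplicative.ofAdd 1) (i : ι)
    (v w : FreeGroup ι) :
    normalize hα i (v * w) =
      normalize hα i v * MulAut.conjNormal (FreeGroup.of i ^ (α v).toAdd) (normalize hα i w) := by
  ext
  rw [Subgroup.coe_mul, MulAut.conjNormal_apply]
  simp only [normalize, map_mul, toAdd_mul, neg_add_rev, zpow_add, zpow_neg]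
  group

/-- The vectors `b` with `b i₀ = 0` and the standard basis vectors at the other indices. -/
noncomputable def basisVec [DecidableEq ι] (i₀ : ι) (i : ι) : {j // j ≠ i₀} → LaurentPolynomial ℤ :=
  if h : i = i₀ then 0 else Pi.single ⟨i, h⟩ 1

/-- The linear combination map with coefficients acting through `laurentEnd`. -/
noncomputable def moduleToKerAb [Fintype ι] [DecidableEq ι] {i₀ : ι} (β : {j : ι // j ≠ i₀} → α.ker) :
    ({j : ι // j ≠ i₀} → LaurentPolynomial ℤ) →+ Additive (Abelianization α.ker) where
  toFun m := ∑ j, laurentEnd α.ker (FreeGroup.of i₀) (m j)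
    (Additive.ofMul (Abelianization.of (β j)))
  map_zero' := by simp
  map_add' m n := by simp [Finset.sum_add_distrib]

theorem moduleToKerAb_apply [Fintype ι] [DecidableEq ι] {i₀ : ι} (β : {j : ι // j ≠ i₀} → α.ker)
    (m : {j : ι // j ≠ i₀} → LaurentPolynomial ℤ) :
    moduleToKerAb β m = ∑ j, laurentEnd α.ker (FreeGroup.of i₀) (m j)
      (Additive.ofMul (Abelianization.of (β j))) := rfl

theorem moduleToKerAb_smul [Fintype ι] [DecidableEq ι] {i₀ : ι} (β : {j : ι // j ≠ i₀} → α.ker)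
    (p : LaurentPolynomial ℤ) (m : {j : ι // j ≠ i₀} → LaurentPolynomial ℤ) :
    moduleToKerAb β (p • m) = laurentEnd α.ker (FreeGroup.of i₀) p (moduleToKerAb β m) := by
  simp [moduleToKerAb_apply]

theorem moduleToKerAb_single [Fintype ι] [DecidableEq ι] {i₀ : ι} (β : {j : ι // j ≠ i₀} → α.ker) (j : {j : ι // j ≠ i₀}) :
    moduleToKerAb β (Pi.single j 1) = Additive.ofMul (Abelianization.of (β j)) := by
  rw [moduleToKerAb_apply, Finset.sum_eq_single j]
  · simp
  · intro k _ hk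
    simp [Pi.single_eq_of_ne hk]
  · simp

theorem moduleToKerAb_affineAction [Fintype ι] [DecidableEq ι]
    (hα : ∀ i, α (FreeGroup.of i) = Multiplicative.ofAdd 1)
    {i₀ : ι} {β : {j : ι // j ≠ i₀} → α.ker}
    (hβ : ∀ j, (β j : FreeGroup ι) = FreeGroup.of j.1 * (FreeGroup.of i₀)⁻¹) (w : FreeGroup ι) :
    moduleToKerAb β (affineAction (basisVec i₀) w 0) =
      Additive.ofMul (Abelianization.of (normalize hα i₀ w)) := by
  have key : ∀ v w : FreeGroup ι,
      moduleToKerAb β (affineAction (basisVec i₀) (v * w) 0) =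
        conjEnd α.ker (FreeGroup.of i₀ ^ (α v).toAdd)
          (moduleToKerAb β (affineAction (basisVec i₀) w 0)) +
        moduleToKerAb β (affineAction (basisVec i₀) v 0) := fun v w => by
    rw [affineAction_mul_zero _ hα, map_add, moduleToKerAb_smul, laurentEnd_T]
  have key' : ∀ v w : FreeGroup ι,
      Additive.ofMul (Abelianization.of (normalize hα i₀ (v * w))) =
        conjEnd α.ker (FreeGroup.of i₀ ^ (α v).toAdd)
          (Additive.ofMul (Abelianization.of (normalize hα i₀ w))) +
        Additive.ofMul (Abelianization.of (normalize hα i₀ v)) := fun v w => by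
    rw [normalize_mul, map_mul, ofMul_mul, conjEnd_of, add_comm]
  have h_one : Additive.ofMul (Abelianization.of (normalize hα i₀ 1)) = 0 := by
    have : normalize hα i₀ 1 = 1 := by ext; simp [normalize]
    rw [this, map_one, ofMul_one]
  induction w using FreeGroup.induction_on with
  | C1 => rw [h_one, map_one, Equiv.Perm.one_apply, map_zero]
  | of i =>
    rw [affineAction_of, smul_zero, zero_add, basisVec]
    split_ifs with h
    · subst h
      have : normalize hα i (FreeGroup.of i) = 1 := by ext; simp [normalize, hα]
      rw [this, map_zero, map_one, ofMul_one]
    · have : normalize hα i₀ (FreeGroup.of i) = β ⟨i, h⟩ := by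
        ext; simp [normalize, hα, hβ]
      rw [this, moduleToKerAb_single]
  | inv_of i hi =>
    have h₁ := key (FreeGroup.of i)⁻¹ (FreeGroup.of i)
    have h₂ := key' (FreeGroup.of i)⁻¹ (FreeGroup.of i)
    rw [inv_mul_cancel, map_one, Equiv.Perm.one_apply, map_zero, hi] at h₁
    rw [inv_mul_cancel, h_one] at h₂
    exact add_left_cancel (h₁.symm.trans h₂)
  | mul v w hv hw => rw [key, key', hv, hw]

theorem kerAbToModule_basisVec_of [DecidableEq ι]
    (hα : ∀ i, α (FreeGroup.of i) = Multiplicative.ofAdd 1)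
    {i₀ : ι} {β : {j : ι // j ≠ i₀} → α.ker}
    (hβ : ∀ j, (β j : FreeGroup ι) = FreeGroup.of j.1 * (FreeGroup.of i₀)⁻¹)
    (j : {j : ι // j ≠ i₀}) :
    kerAbToModule (basisVec i₀) hα (Additive.ofMul (Abelianization.of (β j))) =
      Pi.single j 1 := by
  have h := affineAction_mul_zero (basisVec i₀) hα (FreeGroup.of i₀)⁻¹ (FreeGroup.of i₀)
  rw [inv_mul_cancel, map_one, Equiv.Perm.one_apply, affineAction_of, smul_zero, zero_add,
    basisVec, dif_pos rfl, smul_zero, zero_add] at h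
  rw [kerAbToModule_of, hβ, affineAction_mul_zero _ hα, ← h, smul_zero, zero_add,
    affineAction_of, smul_zero, zero_add, basisVec, dif_neg j.2]

/-- The abelianized kernel of `α` is free over `ℤ[t,t⁻¹]` on the classes of the `β j`. -/
noncomputable def kerAbEquiv [Fintype ι] [DecidableEq ι]
    (hα : ∀ i, α (FreeGroup.of i) = Multiplicative.ofAdd 1)
    {i₀ : ι} {β : {j : ι // j ≠ i₀} → α.ker}
    (hβ : ∀ j, (β j : FreeGroup ι) = FreeGroup.of j.1 * (FreeGroup.of i₀)⁻¹) :
    Additive (Abelianization α.ker) ≃+ ({j : ι // j ≠ i₀} → LaurentPolynomial ℤ) where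
  __ := kerAbToModule (basisVec i₀) hα
  invFun := moduleToKerAb β
  left_inv x := by
    obtain ⟨a, rfl⟩ := ofMul_abelianizationOf_surjective _ x
    have h : normalize hα i₀ a = a := by
      ext
      simp [normalize, MonoidHom.mem_ker.1 a.2]
    exact (moduleToKerAb_affineAction hα hβ a).trans (by rw [h])
  right_inv m := by
    change kerAbToModule (basisVec i₀) hα (moduleToKerAb β m) = m
    simp_rw [moduleToKerAb_apply, map_sum, kerAbToModule_laurentEnd,
      kerAbToModule_basisVec_of hα hβ]
    exact (pi_eq_sum_univ' m).symm

end Inverse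

end WindingKernel


/-- The abelianization `R₀/R₀'` of the kernel `R₀` of the winding number map is a
free `ℤ[t,t⁻¹]`-module of rank `s-2`, where `t` acts by conjugation by `x₁`, with free basis the
classes of `β_j = x_j x₁⁻¹` for `2 ≤ j ≤ s-1`.  This is expressed by an additive isomorphism
`e` from `R₀/R₀'` to the free module `({j // j ≠ 0} → ℤ[t,t⁻¹])` which intertwines conjugation
by `x₁` with multiplication by `t = T 1`, and sends the class of `β_j` to the `j`-th standard
basis vector. -/
theorem stmt_3 (s : ℕ) (hs : 3 ≤ s)
    (α : FreeGroup (Fin (s-1)) →* Multiplicative ℤ)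
    (hα : ∀ i, α (FreeGroup.of i) = Multiplicative.ofAdd 1)
    (β : {j : Fin (s-1) // j ≠ ⟨0, by omega⟩} → α.ker)
    (hβ : ∀ j, (β j : FreeGroup (Fin (s-1))) =
      FreeGroup.of j.1 * (FreeGroup.of (⟨0, by omega⟩ : Fin (s-1)))⁻¹) :
    ∃ e : Additive (Abelianization α.ker) ≃+
        ({j : Fin (s-1) // j ≠ ⟨0, by omega⟩} → LaurentPolynomial ℤ),
      (∀ a : α.ker,
        e (Additive.ofMul (Abelianization.of
            (⟨FreeGroup.of (⟨0, by omega⟩ : Fin (s-1)) * ↑a *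
                (FreeGroup.of (⟨0, by omega⟩ : Fin (s-1)))⁻¹,
              (MonoidHom.normal_ker α).conj_mem ↑a a.2 _⟩ : α.ker))) =
          fun j => LaurentPolynomial.T 1 * e (Additive.ofMul (Abelianization.of a)) j) ∧
      (∀ j, e (Additive.ofMul (Abelianization.of (β j))) = Pi.single j 1) := by
  refine ⟨WindingKernel.kerAbEquiv hα hβ, fun a => ?_, fun j => ?_⟩
  · have h := WindingKernel.affineAction_conj_zero
      (WindingKernel.basisVec (⟨0, by omega⟩ : Fin (s-1))) hα
      (FreeGroup.of (⟨0, by omega⟩ : Fin (s-1))) a.2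
    rw [hα] at h
    exact h
  · exact WindingKernel.kerAbToModule_basisVec_of hα hβ j
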